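/- For every natural number M, the six-loop twist-2 ABJM anomalous dimension γ₆ (defined as the combination γ₆(N) = 128(S_{−5}+S₅) − 192(S_{−1,−4}+S_{1,−4}) − 192(S_{−1,4}+S_{1,4}) − 256(S_{−2,−3}+S_{2,−3}) − 256(S_{−2,3}+S_{2,3}) − 160(S_{−3,−2}+S_{3,−2}) − 160(S_{−3,2}+S_{3,2}) − 128(S_{−4,−1}+S_{4,−1}) − 128(S_{−4,1}+S_{4,1}) + 96(S_{−1,−3,−1}+S_{1,−3,−1}) + 96(S_{−1,−3,1}+S_{1,−3,1}) + 96(S_{−1,−2,−2}+S_{1,−2,−2}) + 96(S_{−1,−2,2}+S_{1,−2,2}) + 128(S_{−1,−1,−3}+S_{1,−1,−3}) + 128(S_{−1,−1,3}+S_{1,−1,3}) + 128(S_{−1,1,−3}+S_{1,1,−3}) + 128(S_{−1,1,3}+S_{1,1,3}) + 96(S_{−1,2,−2}+S_{1,2,−2}) + 96(S_{−1,2,2}+S_{1,2,2}) + 96(S_{−1,3,−1}+S_{1,3,−1}) + 96(S_{−1,3,1}+S_{1,3,1}) + 96(S_{−2,−2,−1}+S_{2,−2,−1}) + 96(S_{−2,−2,1}+S_{2,−2,1})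 + 80(S_{−2,−1,−2}+S_{2,−1,−2}) + 80(S_{−2,−1,2}+S_{2,−1,2}) + 80(S_{−2,1,−2}+S_{2,1,−2}) + 80(S_{−2,1,2}+S_{2,1,2}) + 96(S_{−2,2,−1}+S_{2,2,−1}) + 96(S_{−2,2,1}+S_{2,2,1}) + 32(S_{−3,−1,−1}+S_{3,−1,−1}) + 32(S_{−3,−1,1}+S_{3,−1,1}) + 32(S_{−3,1,−1}+S_{3,1,−1}) + 32(S_{−3,1,1}+S_{3,1,1}) − 32(S_{−1,−1,−2,−1}+S_{1,−1,−2,−1}) − 32(S_{−1,−1,−2,1}+S_{1,−1,−2,1}) − 32(S_{−1,−1,2,−1}+S_{1,−1,2,−1}) − 32(S_{−1,−1,2,1}+S_{1,−1,2,1}) − 32(S_{−1,1,−2,−1}+S_{1,1,−2,−1}) − 32(S_{−1,1,−2,1}+S_{1,1,−2,1}) − 32(S_{−1,1,2,−1}+S_{1,1,2,−1}) − 32(S_{−1,1,2,1}+S_{1,1,2,1}), each sum evaluated at N) satisfies the reshuffling identity γ₆(2M) = 8·S₅(M) − 24·S_{1,4}(M) − 32·S_{2,3}(M) − 20·S_{3,2}(M)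 − 16·S_{4,1}(M) + 32·S_{1,1,3}(M) + 24·S_{1,2,2}(M) + 24·S_{1,3,1}(M) + 20·S_{2,1,2}(M) + 24·S_{2,2,1}(M) + 8·S_{3,1,1}(M) − 16·S_{1,1,2,1}(M). -/

import Mathlib

/-- Nested (signed) harmonic sum `S_{a₁,…,a_ℓ}(N)`,
`S_{a₁,…,a_ℓ}(N) = Σ_{n=1}^{N} (sign a₁)^n / n^{|a₁|} · S_{a₂,…,a_ℓ}(n)`, with `S_{}(n) = 1`. -/
noncomputable def nestedS : List ℤ → ℕ → ℝ
  | [], _ => 1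
  | a :: b, N => ∑ n ∈ Finset.Icc 1 N, ((Int.sign a : ℝ)) ^ n / (n : ℝ) ^ a.natAbs * nestedS b n

/-- Six-loop twist-2 ABJM (asymptotic) anomalous dimension `γ₆^{ABA}(N)`. -/
noncomputable def gammaSixTwistTwo (N : ℕ) : ℝ :=
  128 * (nestedS [-5] N + nestedS [5] N)
      - 192 * (nestedS [-1, -4] N + nestedS [1, -4] N)
      - 192 * (nestedS [-1, 4] N + nestedS [1, 4] N)
      - 256 * (nestedS [-2, -3] N + nestedS [2, -3] N)
      - 256 * (nestedS [-2, 3] N + nestedS [2, 3] N)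
      - 160 * (nestedS [-3, -2] N + nestedS [3, -2] N)
      - 160 * (nestedS [-3, 2] N + nestedS [3, 2] N)
      - 128 * (nestedS [-4, -1] N + nestedS [4, -1] N)
      - 128 * (nestedS [-4, 1] N + nestedS [4, 1] N)
      + 96 * (nestedS [-1, -3, -1] N + nestedS [1, -3, -1] N)
      + 96 * (nestedS [-1, -3, 1] N + nestedS [1, -3, 1] N)
      + 96 * (nestedS [-1, -2, -2] N + nestedS [1, -2, -2] N)
      + 96 * (nestedS [-1, -2, 2] N + nestedS [1, -2, 2] N)
      + 128 * (nestedS [-1, -1, -3] N + nestedS [1, -1, -3] N)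
      + 128 * (nestedS [-1, -1, 3] N + nestedS [1, -1, 3] N)
      + 128 * (nestedS [-1, 1, -3] N + nestedS [1, 1, -3] N)
      + 128 * (nestedS [-1, 1, 3] N + nestedS [1, 1, 3] N)
      + 96 * (nestedS [-1, 2, -2] N + nestedS [1, 2, -2] N)
      + 96 * (nestedS [-1, 2, 2] N + nestedS [1, 2, 2] N)
      + 96 * (nestedS [-1, 3, -1] N + nestedS [1, 3, -1] N)
      + 96 * (nestedS [-1, 3, 1] N + nestedS [1, 3, 1] N)
      + 96 * (nestedS [-2, -2, -1] N + nestedS [2, -2, -1] N)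
      + 96 * (nestedS [-2, -2, 1] N + nestedS [2, -2, 1] N)
      + 80 * (nestedS [-2, -1, -2] N + nestedS [2, -1, -2] N)
      + 80 * (nestedS [-2, -1, 2] N + nestedS [2, -1, 2] N)
      + 80 * (nestedS [-2, 1, -2] N + nestedS [2, 1, -2] N)
      + 80 * (nestedS [-2, 1, 2] N + nestedS [2, 1, 2] N)
      + 96 * (nestedS [-2, 2, -1] N + nestedS [2, 2, -1] N)
      + 96 * (nestedS [-2, 2, 1] N + nestedS [2, 2, 1] N)
      + 32 * (nestedS [-3, -1, -1] N + nestedS [3, -1, -1] N)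
      + 32 * (nestedS [-3, -1, 1] N + nestedS [3, -1, 1] N)
      + 32 * (nestedS [-3, 1, -1] N + nestedS [3, 1, -1] N)
      + 32 * (nestedS [-3, 1, 1] N + nestedS [3, 1, 1] N)
      - 32 * (nestedS [-1, -1, -2, -1] N + nestedS [1, -1, -2, -1] N)
      - 32 * (nestedS [-1, -1, -2, 1] N + nestedS [1, -1, -2, 1] N)
      - 32 * (nestedS [-1, -1, 2, -1] N + nestedS [1, -1, 2, -1] N)
      - 32 * (nestedS [-1, -1, 2, 1] N + nestedS [1, -1, 2, 1] N)
      - 32 * (nestedS [-1, 1, -2, -1] N + nestedS [1, 1, -2, -1] N)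
      - 32 * (nestedS [-1, 1, -2, 1] N + nestedS [1, 1, -2, 1] N)
      - 32 * (nestedS [-1, 1, 2, -1] N + nestedS [1, 1, 2, -1] N)
      - 32 * (nestedS [-1, 1, 2, 1] N + nestedS [1, 1, 2, 1] N)

/-- All lists obtained from `a` by choosing a sign for each entry. -/
def signings : List ℕ → List (List ℤ)
  | [] => [[]]
  | a :: b => (signings b).map (List.cons (-(a : ℤ))) ++ (signings b).map (List.cons (a : ℤ))

lemma sum_map_nestedS_cons (c : ℤ) (L : List (List ℤ)) (N : ℕ) :
    (L.map fun b => nestedS (c :: b) N).sum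
      = ∑ n ∈ Finset.Icc 1 N, ((Int.sign c : ℝ)) ^ n / (n : ℝ) ^ c.natAbs *
          (L.map fun b => nestedS b n).sum := by
  induction L with
  | nil => simp
  | cons b L ih =>
    simp only [List.map_cons, List.sum_cons, ih, mul_add, Finset.sum_add_distrib]
    rfl

/-- Adding the alternating and the plain sum up to `2 * M` keeps only the even indices. -/
lemma sum_alternating_add_sum (a : ℕ) (f : ℕ → ℝ) (M : ℕ) :
    ∑ n ∈ Finset.Icc 1 (2 * M), (-1 : ℝ) ^ n / (n : ℝ) ^ a * f n
        + ∑ n ∈ Finset.Icc 1 (2 * M), (1 : ℝ) ^ n / (n : ℝ) ^ a * f n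
      = 2 / 2 ^ a * ∑ n ∈ Finset.Icc 1 M, (1 : ℝ) ^ n / (n : ℝ) ^ a * f (2 * n) := by
  induction M with
  | zero => simp
  | succ M ih =>
    rw [show 2 * (M + 1) = 2 * M + 1 + 1 by ring]
    simp only [Finset.sum_Icc_succ_top (Nat.le_add_left 1 _), mul_add, ← ih]
    rw [show 2 * M + 2 * 1 = 2 * M + 1 + 1 by ring,
      show ((2 * M + 1 + 1 : ℕ) : ℝ) = 2 * ((M + 1 : ℕ) : ℝ) by push_cast; ring, mul_pow]
    simp only [pow_succ, pow_mul, one_pow]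
    field_simp
    ring

/-- The sum over all choices of signs of a harmonic sum at `2 * M` is a multiple of the
harmonic sum with positive indices at `M`. -/
lemma sum_signings_nestedS (a : List ℕ) (ha : ∀ x ∈ a, 0 < x) (M : ℕ) :
    ((signings a).map fun b => nestedS b (2 * M)).sum
      = 2 ^ a.length / 2 ^ a.sum * nestedS (a.map (Nat.cast : ℕ → ℤ)) M := by
  induction a generalizing M with
  | nil => simp [signings, nestedS]
  | cons x a ih =>
    have hx : 0 < x := ha x (by simp)
    have hx' : (x : ℤ).sign = 1 := Int.sign_eq_one_of_pos (by exact_mod_cast hx)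
    have ih' := ih fun y hy => ha y (by simp [hy])
    simp only [signings, List.map_append, List.map_map, List.sum_append, Function.comp_def,
      sum_map_nestedS_cons, Int.sign_neg, hx', Int.natAbs_neg, Int.natAbs_natCast, Int.cast_neg,
      Int.cast_one, sum_alternating_add_sum, ih']
    simp only [List.map_cons, nestedS, hx', Int.natAbs_natCast, Int.cast_one, List.length_cons,
      List.sum_cons, Finset.mul_sum]
    refine Finset.sum_congr rfl fun n _ => ?_
    rw [pow_succ, pow_add]
    field_simp

/-- Reshuffling of the six-loop twist-2 ABJM anomalous dimension at even spin `N = 2M`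
in terms of harmonic sums with positive indices and argument `M`. -/
theorem twist2_six_loop_reshuffling (M : ℕ) :
    gammaSixTwistTwo (2 * M)
      = 8 * nestedS [5] M
      - 24 * nestedS [1, 4] M
      - 32 * nestedS [2, 3] M
      - 20 * nestedS [3, 2] M
      - 16 * nestedS [4, 1] M
      + 32 * nestedS [1, 1, 3] M
      + 24 * nestedS [1, 2, 2] M
      + 24 * nestedS [1, 3, 1] M
      + 20 * nestedS [2, 1, 2] M
      + 24 * nestedS [2, 2, 1] M
      + 8 * nestedS [3, 1, 1] M
      - 16 * nestedS [1, 1, 2, 1] M := by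
  have h5 := sum_signings_nestedS [5] (by simp) M
  have h14 := sum_signings_nestedS [1, 4] (by simp) M
  have h23 := sum_signings_nestedS [2, 3] (by simp) M
  have h32 := sum_signings_nestedS [3, 2] (by simp) M
  have h41 := sum_signings_nestedS [4, 1] (by simp) M
  have h113 := sum_signings_nestedS [1, 1, 3] (by simp) M
  have h122 := sum_signings_nestedS [1, 2, 2] (by simp) M
  have h131 := sum_signings_nestedS [1, 3, 1] (by simp) M
  have h212 := sum_signings_nestedS [2, 1, 2] (by simp) M
  have h221 := sum_signings_nestedS [2, 2, 1] (by simp) M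
  have h311 := sum_signings_nestedS [3, 1, 1] (by simp) M
  have h1121 := sum_signings_nestedS [1, 1, 2, 1] (by simp) M
  norm_num [signings] at h5 h14 h23 h32 h41 h113 h122 h131 h212 h221 h311 h1121
  unfold gammaSixTwistTwo
  linarith
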